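/- Let N ≥ 2 be an even integer and a a real number with 0 < a < 1. Then Σ_{l=1}^{N−1} Σ_{n=1}^{∞} cos(2πnl/N) · (−1)^l · aⁿ/n = ln((1 + a^{N/2})/(1 − a^{N/2})) + ln(1 − a). -/

import Mathlib

/-- The cosine sum over a full period, twisted by alternating signs, is an indicator function. -/
theorem sum_range_cos_mul_neg_one_pow (M : ℕ) (hM : 0 < M) (m : ℕ) :
    ∑ l ∈ Finset.range (2 * M),
        Real.cos (2 * Real.pi * m * l / (2 * M : ℕ)) * (-1 : ℝ) ^ l
      = if 2 * M ∣ m + M then (2 * M : ℝ) else 0 := by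
  have hM' : (M : ℂ) ≠ 0 := by exact_mod_cast hM.ne'
  set z : ℂ := Complex.exp (2 * Real.pi * Complex.I / (2 * M : ℕ)) with hz
  have hprim : IsPrimitiveRoot z (2 * M) := Complex.isPrimitiveRoot_exp (2 * M) (by omega)
  have hzM : z ^ M = -1 := by
    rw [hz, ← Complex.exp_nat_mul, ← Complex.exp_pi_mul_I]
    congr 1
    push_cast
    field_simp
  have hterm (l : ℕ) : Real.cos (2 * Real.pi * m * l / (2 * M : ℕ)) * (-1 : ℝ) ^ l
      = (((z ^ (m + M)) ^ l : ℂ)).re := by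
    have h1 : (z ^ m) ^ l
        = Complex.exp ((2 * Real.pi * m * l / (2 * M : ℕ) : ℝ) * Complex.I) := by
      rw [hz, ← Complex.exp_nat_mul, ← Complex.exp_nat_mul]
      congr 1
      push_cast
      ring
    have h2 : ((-1 : ℂ)) ^ l = (((-1 : ℝ) ^ l : ℝ) : ℂ) := by push_cast; rfl
    rw [pow_add, hzM, mul_pow, h1, h2, Complex.re_mul_ofReal, Complex.exp_ofReal_mul_I_re]
  rw [Finset.sum_congr rfl fun l _ => hterm l, ← Complex.re_sum]
  split_ifs with h
  · rw [(hprim.pow_eq_one_iff_dvd _).2 h]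
    simp
  · have hne : z ^ (m + M) ≠ 1 := fun h' => h ((hprim.pow_eq_one_iff_dvd _).1 h')
    rw [geom_sum_eq hne, ← pow_mul, mul_comm, pow_mul, hprim.pow_eq_one]
    simp

/-- The part of the logarithm series supported on odd multiples of `M`. -/
theorem hasSum_indicator_dvd_pow_div (M : ℕ) (hM : 0 < M) (a : ℝ) (ha0 : 0 ≤ a) (ha1 : a < 1) :
    HasSum (fun n : ℕ =>
        (if 2 * M ∣ n + 1 + M then (2 * M : ℝ) else 0) * (a ^ (n + 1) / (n + 1)))
      (Real.log ((1 + a ^ M) / (1 - a ^ M))) := by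
  have hpow : a ^ M < 1 := pow_lt_one₀ ha0 ha1 hM.ne'
  have hpow0 : 0 ≤ a ^ M := pow_nonneg ha0 M
  have hodd (j : ℕ) : M * (2 * j + 1) - 1 + 1 = M * (2 * j + 1) :=
    Nat.sub_add_cancel (Nat.mul_pos hM (by omega))
  have hinj : Function.Injective fun j : ℕ => M * (2 * j + 1) - 1 := by
    intro i j hij
    have h : M * (2 * i + 1) = M * (2 * j + 1) := by
      rw [← hodd i, ← hodd j]
      exact congrArg (· + 1) hij
    have := Nat.eq_of_mul_eq_mul_left hM h
    omega
  rw [← hinj.hasSum_iff]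
  · rw [Real.log_div (by linarith) (by linarith)]
    convert Real.hasSum_log_sub_log_of_abs_lt_one (abs_lt.2 ⟨by linarith, hpow⟩) using 2 with j
    have hdvd : 2 * M ∣ M * (2 * j + 1) + M := ⟨j + 1, by ring⟩
    have hcast : ((M * (2 * j + 1) - 1 : ℕ) : ℝ) + 1 = M * (2 * j + 1) := by
      exact_mod_cast hodd j
    have hM' : (M : ℝ) ≠ 0 := by exact_mod_cast hM.ne'
    have hj : (2 * (j : ℝ) + 1) ≠ 0 := by positivity
    simp only [Function.comp_apply]
    rw [hcast, hodd, if_pos hdvd, pow_mul]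
    field_simp
  · intro n hn
    rw [if_neg, zero_mul]
    rintro ⟨k, hk⟩
    apply hn
    obtain _ | k := k
    · omega
    · refine ⟨k, ?_⟩
      have : n + 1 = M * (2 * k + 1) := by linarith
      simp only
      omega


/-- For `N ≥ 2` even and `0 < a < 1`,
`Σ_{l=1}^{N−1} Σ_{n=1}^{∞} cos(2πnl/N)·(−1)^l·aⁿ/n
  = ln((1 + a^{N/2})/(1 − a^{N/2})) + ln(1 − a)`. -/
theorem rho_half_closed_form (N : ℕ) (hN : 2 ≤ N) (hNeven : Even N)
    (a : ℝ) (ha0 : 0 < a) (ha1 : a < 1) :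
    ∑ l ∈ Finset.Ico 1 N, ∑' n : ℕ,
        Real.cos (2 * Real.pi * (n + 1) * l / N) * (-1 : ℝ) ^ l * a ^ (n + 1) / (n + 1)
      = Real.log ((1 + a ^ (N / 2)) / (1 - a ^ (N / 2))) + Real.log (1 - a) := by
  obtain ⟨M, rfl⟩ := hNeven.two_dvd
  have hM : 0 < M := by omega
  have habs : |a| < 1 := by rwa [abs_of_pos ha0]
  have hlog := Real.hasSum_pow_div_log_of_abs_lt_one habs
  have hsummable (l : ℕ) : Summable fun n : ℕ =>
      Real.cos (2 * Real.pi * (n + 1) * l / (2 * M : ℕ)) * (-1 : ℝ) ^ l * a ^ (n + 1)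
        / (n + 1) := by
    refine Summable.of_norm_bounded hlog.summable fun n => ?_
    have h : 0 ≤ a ^ (n + 1) / ((n : ℝ) + 1) := by positivity
    rw [mul_div_assoc, norm_mul, norm_mul, norm_pow, norm_neg, norm_one, one_pow, mul_one,
      Real.norm_of_nonneg h]
    exact mul_le_of_le_one_left h (Real.abs_cos_le_one _)
  have hfull := hasSum_sum (s := Finset.range (2 * M)) fun l _ => (hsummable l).hasSum
  have hswap := hasSum_indicator_dvd_pow_div M hM a ha0.le ha1
  have hsum := hfull.unique <| by
    convert hswap using 2 with n
    rw [← sum_range_cos_mul_neg_one_pow M hM (n + 1), Finset.sum_mul]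
    refine Finset.sum_congr rfl fun l _ => ?_
    push_cast
    ring
  rw [Finset.range_eq_Ico, Finset.sum_eq_sum_Ico_succ_bot (by omega)] at hsum
  have hzero : ∑' n : ℕ, Real.cos (2 * Real.pi * (n + 1) * (0 : ℕ) / (2 * M : ℕ))
      * (-1 : ℝ) ^ 0 * a ^ (n + 1) / (n + 1) = -Real.log (1 - a) := by
    simpa using hlog.tsum_eq
  rw [hzero] at hsum
  rw [Nat.mul_div_cancel_left M two_pos, ← hsum]
  simp only [zero_add]
  ring
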